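/- Let q = 2^h be a power of 2 and F a finite field with q elements. Let W₉ = { [[x, y, 0], [y, z, z], [0, z, 0]] : x, y, z ∈ F } and W₁₀ = { [[x, y, 0], [y, z, 0], [0, 0, z]] : x, y, z ∈ F } in Sym₃(F). Then the point-orbit distribution of W₁₀ is [1, 1, 2q−1, q²−q] (exactly one rank-1 point, one rank-2 point with zero diagonal, 2q−1 rank-2 points with nonzero diagonal, and q²−q rank-3 points), and moreover W₁₀ is not equivalent to W₉: there is no A ∈ GL(3,F) with { A M Aᵀ : M ∈ W₉ } = W₁₀. -/

import Mathlib

open Matrix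

/-- A *point* of a plane `W` of `PG(5,q)` (viewed as a 3-dimensional linear subspace of the
space of symmetric `3×3` matrices): a 1-dimensional linear subspace `P ≤ W`, all of whose
nonzero matrices satisfy the predicate `pred` (e.g. a rank condition). -/
def IsPointOf (F : Type) [Field F] (W P : Submodule F (Matrix (Fin 3) (Fin 3) F))
    (pred : Matrix (Fin 3) (Fin 3) F → Prop) : Prop :=
  P ≤ W ∧ Module.finrank F ↥P = 1 ∧ ∀ M ∈ P, M ≠ 0 → pred M

section MatrixRank

variable {K : Type*} [Field K] {n : Type*} [Fintype n]

theorem card_le_rank_of_det_submatrix_ne_zero {k : ℕ} (M : Matrix n n K) (r c : Fin k → n)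
    (hdet : (M.submatrix r c).det ≠ 0) : k ≤ M.rank := by
  simpa [rank_of_det_ne_zero hdet] using rank_submatrix_le M r c

theorem rank_eq_card_iff_det_ne_zero [DecidableEq n] (M : Matrix n n K) :
    M.rank = Fintype.card n ↔ M.det ≠ 0 := by
  refine ⟨fun hM => ?_, rank_of_det_ne_zero⟩
  have hsurj : Function.Surjective M.mulVec := by
    have htop : LinearMap.range M.mulVecLin = ⊤ :=
      Submodule.eq_top_of_finrank_eq (by rw [Module.finrank_fintype_fun_eq_card]; exact hM)
    exact LinearMap.range_eq_top.mp htop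
  exact ((isUnit_iff_isUnit_det M).mp (mulVec_surjective_iff_isUnit.mp hsurj)).ne_zero

end MatrixRank

/-- Points can be counted through a family of normalised spanning matrices. -/
theorem card_isPointOf_eq {F : Type} [Field F] {W : Submodule F (Matrix (Fin 3) (Fin 3) F)}
    {pred : Matrix (Fin 3) (Fin 3) F → Prop}
    (hsmul : ∀ (c : F) (M : Matrix (Fin 3) (Fin 3) F), c ≠ 0 → pred M → pred (c • M))
    {ι : Type*} (g : ι → Matrix (Fin 3) (Fin 3) F) (hne : ∀ i, g i ≠ 0) (hmem : ∀ i, g i ∈ W)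
    (hpred : ∀ i, pred (g i)) (hinj : ∀ i j (c : F), c • g j = g i → i = j)
    (hsurj : ∀ M ∈ W, M ≠ 0 → pred M → ∃ i, ∃ c : F, c • g i = M) :
    Nat.card {P | IsPointOf F W P pred} = Nat.card ι := by
  symm
  refine Nat.card_congr (Equiv.ofBijective
    (fun i => (⟨Submodule.span F {g i}, ?_⟩ : {P | IsPointOf F W P pred})) ⟨?_, ?_⟩)
  · refine ⟨(Submodule.span_singleton_le_iff_mem _ _).mpr (hmem i),
      finrank_span_singleton (hne i), fun M hM hM0 => ?_⟩
    obtain ⟨c, rfl⟩ := Submodule.mem_span_singleton.mp hM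
    exact hsmul c _ (fun hc => hM0 (by rw [hc, zero_smul])) (hpred i)
  · intro i j hij
    have hspan : Submodule.span F {g i} = Submodule.span F {g j} := congrArg Subtype.val hij
    have hi : g i ∈ Submodule.span F {g j} := hspan ▸ Submodule.mem_span_singleton_self _
    obtain ⟨c, hc⟩ := Submodule.mem_span_singleton.mp hi
    exact hinj i j c hc
  · rintro ⟨P, hPW, hP1, hP⟩
    obtain ⟨⟨v, hvP⟩, hv0, hv⟩ := finrank_eq_one_iff'.mp hP1
    have hv0' : v ≠ 0 := fun hv' => hv0 (Subtype.ext hv')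
    obtain ⟨i, c, rfl⟩ := hsurj v (hPW hvP) hv0' (hP v hvP hv0')
    have hc : c ≠ 0 := fun hc => hv0' (by rw [hc, zero_smul])
    refine ⟨i, Subtype.ext ?_⟩
    change Submodule.span F {g i} = P
    rw [← Submodule.span_singleton_smul_eq hc.isUnit]
    refine le_antisymm ((Submodule.span_singleton_le_iff_mem _ _).mpr hvP) fun w hw => ?_
    obtain ⟨d, hd⟩ := hv ⟨w, hw⟩
    exact Submodule.mem_span_singleton.mpr ⟨d, congrArg Subtype.val hd⟩

section Sigma

variable {F : Type} [Field F]

/-- The general matrix of the plane `Σ₁₀`. -/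
def sigma10Matrix (x y z : F) : Matrix (Fin 3) (Fin 3) F :=
  !![x, y, 0; y, z, 0; 0, 0, z]

theorem smul_sigma10Matrix (c x y z : F) :
    c • sigma10Matrix x y z = sigma10Matrix (c * x) (c * y) (c * z) := by
  simp [sigma10Matrix]

theorem sigma10Matrix_inj {x y z x' y' z' : F} :
    sigma10Matrix x y z = sigma10Matrix x' y' z' ↔ x = x' ∧ y = y' ∧ z = z' := by
  refine ⟨fun hM => ⟨?_, ?_, ?_⟩, by rintro ⟨rfl, rfl, rfl⟩; rfl⟩
  · simpa [sigma10Matrix] using congrFun₂ hM 0 0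
  · simpa [sigma10Matrix] using congrFun₂ hM 0 1
  · simpa [sigma10Matrix] using congrFun₂ hM 1 1

theorem sigma10Matrix_eq_zero_iff {x y z : F} :
    sigma10Matrix x y z = 0 ↔ x = 0 ∧ y = 0 ∧ z = 0 := by
  rw [← sigma10Matrix_inj, show sigma10Matrix (0 : F) 0 0 = 0 by
    ext i j; fin_cases i <;> fin_cases j <;> rfl]

theorem det_sigma10Matrix (x y z : F) :
    (sigma10Matrix x y z).det = z * (x * z - y ^ 2) := by
  simp [sigma10Matrix, det_fin_three]
  ring

theorem sigma10Matrix_diag_eq_zero_iff {x y z : F} :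
    (∀ i, sigma10Matrix x y z i i = 0) ↔ x = 0 ∧ z = 0 := by
  simp [sigma10Matrix, Fin.forall_fin_succ]

theorem rank_sigma10Matrix_eq_three_iff {x y z : F} :
    (sigma10Matrix x y z).rank = 3 ↔ z ≠ 0 ∧ x * z ≠ y ^ 2 := by
  have hrank := rank_eq_card_iff_det_ne_zero (sigma10Matrix x y z)
  rwa [Fintype.card_fin, det_sigma10Matrix, mul_ne_zero_iff, sub_ne_zero] at hrank

theorem two_le_rank_sigma10Matrix_iff {x y z : F} :
    2 ≤ (sigma10Matrix x y z).rank ↔ y ≠ 0 ∨ z ≠ 0 := by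
  constructor
  · contrapose!
    rintro ⟨rfl, rfl⟩
    have hM : sigma10Matrix x 0 0 = vecMulVec ![x, 0, 0] ![1, 0, 0] := by
      ext i j; fin_cases i <;> fin_cases j <;> simp [sigma10Matrix, vecMulVec_apply]
    rw [hM]
    exact Nat.lt_succ_of_le (rank_vecMulVec_le _ _)
  · intro hyz
    by_cases hz : z = 0
    · refine card_le_rank_of_det_submatrix_ne_zero _ ![0, 1] ![0, 1] ?_
      rw [det_fin_two]
      simpa [sigma10Matrix, hz] using hyz
    · refine card_le_rank_of_det_submatrix_ne_zero _ ![1, 2] ![1, 2] ?_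
      rw [det_fin_two]
      simpa [sigma10Matrix] using hz

theorem rank_sigma10Matrix_eq_two_iff {x y z : F} :
    (sigma10Matrix x y z).rank = 2 ↔ z = 0 ∧ y ≠ 0 ∨ z ≠ 0 ∧ x * z = y ^ 2 := by
  have hle : (sigma10Matrix x y z).rank ≤ 3 := by
    simpa using rank_le_card_height (sigma10Matrix x y z)
  have h2 := two_le_rank_sigma10Matrix_iff (x := x) (y := y) (z := z)
  have h3 := rank_sigma10Matrix_eq_three_iff (x := x) (y := y) (z := z)
  have : (sigma10Matrix x y z).rank = 2 ↔
      2 ≤ (sigma10Matrix x y z).rank ∧ ¬ (sigma10Matrix x y z).rank = 3 := by omega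
  rw [this, h2, h3]
  tauto

theorem rank_sigma10Matrix_eq_one_iff {x y z : F} :
    (sigma10Matrix x y z).rank = 1 ↔ x ≠ 0 ∧ y = 0 ∧ z = 0 := by
  have h2 := two_le_rank_sigma10Matrix_iff (x := x) (y := y) (z := z)
  constructor
  · intro h1
    have hyz : y = 0 ∧ z = 0 := by
      by_contra hyz
      have := h2.mpr (by tauto)
      omega
    obtain ⟨rfl, rfl⟩ := hyz
    refine ⟨?_, rfl, rfl⟩
    rintro rfl
    rw [sigma10Matrix_eq_zero_iff.mpr ⟨rfl, rfl, rfl⟩, rank_zero] at h1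
    exact zero_ne_one h1
  · rintro ⟨hx, hy, hz⟩
    have h1 : 1 ≤ (sigma10Matrix x y z).rank :=
      card_le_rank_of_det_submatrix_ne_zero _ ![0] ![0] (by
        rw [det_fin_one]
        simpa [sigma10Matrix] using hx)
    have : ¬ 2 ≤ (sigma10Matrix x y z).rank := by rw [h2]; tauto
    omega

theorem rank_smul_of_ne_zero {c : F} (hc : c ≠ 0) (M : Matrix (Fin 3) (Fin 3) F) :
    (c • M).rank = M.rank :=
  rank_smul_of_mem_nonZeroDivisors M (mem_nonZeroDivisors_of_ne_zero hc)

theorem card_sigma10_rank_one {W : Submodule F (Matrix (Fin 3) (Fin 3) F)}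
    (hW : ∀ M, M ∈ W ↔ ∃ x y z : F, M = sigma10Matrix x y z) :
    Nat.card {P | IsPointOf F W P (fun M => M.rank = 1)} = 1 := by
  rw [card_isPointOf_eq (ι := Unit) (fun c M hc hM => (rank_smul_of_ne_zero hc M).trans hM)
    (fun _ => sigma10Matrix 1 0 0)]
  · exact Nat.card_unique
  · simp [sigma10Matrix_eq_zero_iff]
  · exact fun _ => (hW _).mpr ⟨_, _, _, rfl⟩
  · simp [rank_sigma10Matrix_eq_one_iff]
  · exact fun _ _ _ _ => rfl
  · intro M hM _ hr
    obtain ⟨x, y, z, rfl⟩ := (hW M).mp hM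
    obtain ⟨-, rfl, rfl⟩ := rank_sigma10Matrix_eq_one_iff.mp hr
    exact ⟨(), x, by simp [smul_sigma10Matrix]⟩

theorem card_sigma10_rank_two_diag_eq_zero {W : Submodule F (Matrix (Fin 3) (Fin 3) F)}
    (hW : ∀ M, M ∈ W ↔ ∃ x y z : F, M = sigma10Matrix x y z) :
    Nat.card {P | IsPointOf F W P (fun M => M.rank = 2 ∧ ∀ i, M i i = 0)} = 1 := by
  rw [card_isPointOf_eq (ι := Unit) ?_ (fun _ => sigma10Matrix 0 1 0)]
  · exact Nat.card_unique
  · simp [sigma10Matrix_eq_zero_iff]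
  · exact fun _ => (hW _).mpr ⟨_, _, _, rfl⟩
  · simp [rank_sigma10Matrix_eq_two_iff, sigma10Matrix_diag_eq_zero_iff]
  · exact fun _ _ _ _ => rfl
  · rintro M hM - ⟨-, hd⟩
    obtain ⟨x, y, z, rfl⟩ := (hW M).mp hM
    obtain ⟨rfl, rfl⟩ := sigma10Matrix_diag_eq_zero_iff.mp hd
    exact ⟨(), y, by simp [smul_sigma10Matrix]⟩
  · rintro c M hc ⟨hr, hd⟩
    exact ⟨(rank_smul_of_ne_zero hc M).trans hr, fun i => by simp [hd i]⟩

theorem card_sigma10_rank_two_diag_ne_zero [Finite F]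
    {W : Submodule F (Matrix (Fin 3) (Fin 3) F)}
    (hW : ∀ M, M ∈ W ↔ ∃ x y z : F, M = sigma10Matrix x y z) :
    Nat.card {P | IsPointOf F W P (fun M => M.rank = 2 ∧ ∃ i, M i i ≠ 0)} =
      2 * Nat.card F - 1 := by
  have hdiag (x y z : F) : (∃ i, sigma10Matrix x y z i i ≠ 0) ↔ ¬ (x = 0 ∧ z = 0) := by
    rw [← sigma10Matrix_diag_eq_zero_iff (y := y), not_forall]
  rw [card_isPointOf_eq (ι := Fˣ ⊕ F) ?_
    (Sum.elim (fun u => sigma10Matrix 1 (u : F) 0) (fun t => sigma10Matrix (t ^ 2) t 1))]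
  · have := Nat.card_pos (α := F)
    rw [Nat.card_sum, Nat.card_units]
    omega
  · rintro (u | t) <;> simp [sigma10Matrix_eq_zero_iff]
  · rintro (u | t) <;> exact (hW _).mpr ⟨_, _, _, rfl⟩
  · rintro (u | t) <;> simp [rank_sigma10Matrix_eq_two_iff, hdiag]
  · rintro (u | t) (v | s) c hc <;>
      simp only [Sum.elim_inl, Sum.elim_inr, smul_sigma10Matrix, sigma10Matrix_inj, mul_one,
        mul_zero] at hc
    · obtain ⟨rfl, hc, -⟩ := hc
      exact congrArg Sum.inl (Units.ext (by simpa using hc.symm))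
    · obtain ⟨hc1, -, rfl⟩ := hc
      simp at hc1
    · exact absurd hc.2.2 zero_ne_one
    · obtain ⟨-, hc, rfl⟩ := hc
      exact congrArg Sum.inr (by simpa using hc.symm)
  · rintro M hM - ⟨hr, hd⟩
    obtain ⟨x, y, z, rfl⟩ := (hW M).mp hM
    rw [hdiag] at hd
    rcases rank_sigma10Matrix_eq_two_iff.mp hr with ⟨rfl, hy⟩ | ⟨hz, hxz⟩
    · have hx : x ≠ 0 := fun hx => hd ⟨hx, rfl⟩
      refine ⟨Sum.inl (Units.mk0 (y / x) (div_ne_zero hy hx)), x, ?_⟩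
      simp [smul_sigma10Matrix, mul_div_cancel₀ y hx]
    · refine ⟨Sum.inr (y / z), z, ?_⟩
      simp only [Sum.elim_inr, smul_sigma10Matrix, sigma10Matrix_inj]
      refine ⟨?_, ?_, mul_one z⟩
      · field_simp
        rw [← hxz, mul_comm]
      · field_simp
  · rintro c M hc ⟨hr, i, hi⟩
    exact ⟨(rank_smul_of_ne_zero hc M).trans hr, i, by simp [hc, hi]⟩

theorem card_sigma10_rank_three [Finite F] {W : Submodule F (Matrix (Fin 3) (Fin 3) F)}
    (hW : ∀ M, M ∈ W ↔ ∃ x y z : F, M = sigma10Matrix x y z) :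
    Nat.card {P | IsPointOf F W P (fun M => M.rank = 3)} = Nat.card F ^ 2 - Nat.card F := by
  rw [card_isPointOf_eq (ι := F × Fˣ)
    (fun c M hc hM => (rank_smul_of_ne_zero hc M).trans hM)
    (fun p => sigma10Matrix (p.1 ^ 2 + p.2) p.1 1)]
  · rw [Nat.card_prod, Nat.card_units, Nat.mul_sub, mul_one, sq]
  · simp [sigma10Matrix_eq_zero_iff]
  · exact fun _ => (hW _).mpr ⟨_, _, _, rfl⟩
  · simp [rank_sigma10Matrix_eq_three_iff]
  · rintro ⟨t, u⟩ ⟨s, v⟩ c hc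
    simp only [smul_sigma10Matrix, sigma10Matrix_inj, mul_one] at hc
    obtain ⟨hu, ht, rfl⟩ := hc
    rw [one_mul] at hu ht
    subst ht
    exact Prod.ext rfl (Units.ext (add_left_cancel hu).symm)
  · intro M hM _ hr
    obtain ⟨x, y, z, rfl⟩ := (hW M).mp hM
    obtain ⟨hz, hxz⟩ := rank_sigma10Matrix_eq_three_iff.mp hr
    have hu : x / z - (y / z) ^ 2 ≠ 0 := by
      rw [sub_ne_zero]
      intro hxy
      field_simp at hxy
      exact hxz (by rw [← hxy, mul_comm])
    refine ⟨(y / z, Units.mk0 _ hu), z, ?_⟩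
    simp only [Units.val_mk0, smul_sigma10Matrix, sigma10Matrix_inj, add_sub_cancel, mul_one,
      and_true]
    exact ⟨mul_div_cancel₀ x hz, mul_div_cancel₀ y hz⟩

/-- If a nonzero matrix of `Σ₁₀` with zero diagonal is added to a singular one, singularity
persists only on the line `z = 0`. -/
theorem sigma10Matrix_apply_two_two_eq_zero [CharP F 2] {x y z b : F} (hb : b ≠ 0)
    (hdet : (sigma10Matrix x y z).det = 0)
    (hdet' : (sigma10Matrix x y z + sigma10Matrix 0 b 0).det = 0) : z = 0 := by
  have hadd : sigma10Matrix x y z + sigma10Matrix 0 b 0 = sigma10Matrix x (y + b) z := by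
    simp [sigma10Matrix]
  rw [hadd, det_sigma10Matrix, CharTwo.add_sq] at hdet'
  rw [det_sigma10Matrix] at hdet
  have hzb : z * b ^ 2 = 0 := by linear_combination hdet - hdet'
  exact (mul_eq_zero.mp hzb).resolve_right (pow_ne_zero 2 hb)

/-- Congruence preserves the zero-diagonal symmetric matrix `e₀e₁ᵀ + e₁e₀ᵀ` in
characteristic two. -/
theorem diag_congruence_sigma10Matrix_zero_one_zero [CharP F 2] (A : Matrix (Fin 3) (Fin 3) F)
    (i : Fin 3) : (A * sigma10Matrix 0 1 0 * Aᵀ : Matrix (Fin 3) (Fin 3) F) i i = 0 := by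
  simp only [mul_apply, Fin.sum_univ_three, sigma10Matrix, transpose_apply]
  simp [mul_comm (A i 1), CharTwo.add_self_eq_zero]

theorem not_exists_congruence_sigma9_sigma10 [CharP F 2]
    {W₉ W₁₀ : Set (Matrix (Fin 3) (Fin 3) F)}
    (hW₉ : W₉ = {M | ∃ x y z : F, M = !![x, y, 0; y, z, z; 0, z, 0]})
    (hW₁₀ : W₁₀ = {M | ∃ x y z : F, M = sigma10Matrix x y z}) :
    ¬ ∃ A : GL (Fin 3) F, (fun M => (A : Matrix (Fin 3) (Fin 3) F) * M *
      (A : Matrix (Fin 3) (Fin 3) F)ᵀ) '' W₉ = W₁₀ := by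
  rintro ⟨A, hA⟩
  have hdetA : (A : Matrix (Fin 3) (Fin 3) F).det ≠ 0 :=
    ((isUnit_iff_isUnit_det _).mp A.isUnit).ne_zero
  generalize (A : Matrix (Fin 3) (Fin 3) F) = B at hA hdetA
  have hdet (M : Matrix (Fin 3) (Fin 3) F) : (B * M * Bᵀ).det = 0 ↔ M.det = 0 := by
    simp [det_mul, det_transpose, hdetA]
  have himage (x y z : F) : ∃ x' y' z' : F,
      B * !![x, y, 0; y, z, z; 0, z, 0] * Bᵀ = sigma10Matrix x' y' z' := by
    have hmem := hA.subset (Set.mem_image_of_mem _ (hW₉.superset ⟨x, y, z, rfl⟩))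
    rwa [hW₁₀] at hmem
  obtain ⟨a, b, c, hN⟩ := himage 0 1 0
  obtain ⟨x₁, y₁, z₁, h₁⟩ := himage 1 0 0
  obtain ⟨x₂, y₂, z₂, h₂⟩ := himage 0 0 1
  obtain ⟨rfl, rfl⟩ : a = 0 ∧ c = 0 :=
    sigma10Matrix_diag_eq_zero_iff.mp fun i => by
      rw [← hN]
      exact diag_congruence_sigma10Matrix_zero_one_zero B i
  have hb : b ≠ 0 := by
    rintro rfl
    rw [sigma10Matrix_eq_zero_iff.mpr ⟨rfl, rfl, rfl⟩] at hN
    have hB : IsUnit B := (isUnit_iff_isUnit_det B).mpr hdetA.isUnit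
    have hBt : IsUnit Bᵀ := (isUnit_transpose B).mpr hB
    have h0 := hB.mul_right_eq_zero.mp (hBt.mul_left_eq_zero.mp hN)
    simpa using congrFun₂ h0 0 1
  have hz₁ : z₁ = 0 := by
    refine sigma10Matrix_apply_two_two_eq_zero (x := x₁) (y := y₁) hb ?_ ?_
    · rw [← h₁, hdet]
      simp [det_fin_three]
    · rw [← h₁, ← hN, ← Matrix.add_mul, ← Matrix.mul_add, hdet]
      simp [det_fin_three]
  have hz₂ : z₂ = 0 := by
    refine sigma10Matrix_apply_two_two_eq_zero (x := x₂) (y := y₂) hb ?_ ?_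
    · rw [← h₂, hdet]
      simp [det_fin_three]
    · rw [← h₂, ← hN, ← Matrix.add_mul, ← Matrix.mul_add, hdet]
      simp [det_fin_three]
  subst hz₁ hz₂
  have hsum : (sigma10Matrix x₁ y₁ 0 + sigma10Matrix x₂ y₂ 0).det = 0 := by
    simp [sigma10Matrix, det_fin_three]
  rw [← h₁, ← h₂, ← Matrix.add_mul, ← Matrix.mul_add, hdet] at hsum
  simp [det_fin_three] at hsum

end Sigma

/-- The plane `Σ₁₀` has point-orbit distribution `[1, 1, 2q-1, q²-q]`, and it is not
`K`-equivalent to the plane `Σ₉`. -/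
theorem sigma10_point_orbit_distribution_and_not_equiv_sigma9 (h : ℕ) (hh : 0 < h)
    (F : Type) [Field F] [Fintype F] (hF : Fintype.card F = 2 ^ h)
    (W₉ W₁₀ : Submodule F (Matrix (Fin 3) (Fin 3) F))
    (hW₉ : (W₉ : Set (Matrix (Fin 3) (Fin 3) F)) =
      {M | ∃ x y z : F, M = !![x, y, 0; y, z, z; 0, z, 0]})
    (hW₁₀ : (W₁₀ : Set (Matrix (Fin 3) (Fin 3) F)) =
      {M | ∃ x y z : F, M = !![x, y, 0; y, z, 0; 0, 0, z]}) :
    Nat.card {P | IsPointOf F W₁₀ P (fun M => M.rank = 1)} = 1 ∧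
    Nat.card {P | IsPointOf F W₁₀ P (fun M => M.rank = 2 ∧ ∀ i, M i i = 0)} = 1 ∧
    Nat.card {P | IsPointOf F W₁₀ P (fun M => M.rank = 2 ∧ ∃ i, M i i ≠ 0)} = 2 * 2 ^ h - 1 ∧
    Nat.card {P | IsPointOf F W₁₀ P (fun M => M.rank = 3)} = (2 ^ h) ^ 2 - 2 ^ h ∧
    ¬ ∃ A : GL (Fin 3) F,
        (fun M => (A : Matrix (Fin 3) (Fin 3) F) * M * (A : Matrix (Fin 3) (Fin 3) F)ᵀ) ''
          (W₉ : Set (Matrix (Fin 3) (Fin 3) F)) = (W₁₀ : Set (Matrix (Fin 3) (Fin 3) F)) := by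
  have hcard : Nat.card F = 2 ^ h := by rw [Nat.card_eq_fintype_card, hF]
  have : CharP F 2 := by
    refine CharTwo.of_one_ne_zero_of_two_eq_zero one_ne_zero ?_
    have h2 : (2 : F) ^ h = 0 := by exact_mod_cast hF ▸ Nat.cast_card_eq_zero F
    exact pow_eq_zero_iff hh.ne' |>.mp h2
  have hW (M : Matrix (Fin 3) (Fin 3) F) : M ∈ W₁₀ ↔ ∃ x y z : F, M = sigma10Matrix x y z :=
    Set.ext_iff.mp hW₁₀ M
  refine ⟨card_sigma10_rank_one hW, card_sigma10_rank_two_diag_eq_zero hW, ?_, ?_,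
    not_exists_congruence_sigma9_sigma10 hW₉ hW₁₀⟩
  · rw [card_sigma10_rank_two_diag_ne_zero hW, hcard]
  · rw [card_sigma10_rank_three hW, hcard]
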